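/- arXiv:1610.01555 — 2 statements merged into one kernel-verified Lean document; each statement's English description precedes it below -/
import Mathlib

section
/- For a strip of triangles △̄ consisting of n triangles, the space S(△̄) of continuous piecewise linear functions on the strip has dimension n+2, i.e., dim S(△̄) = n+2. -/
open scoped Classical

noncomputable section

/-- Points of the plane. -/
abbrev E : Type := ℝ × ℝ

/-- The closed triangle `Δᵢ` with vertices `V i`, `V (i+1)`, `V (i+2)`. -/
def tri (V : ℕ → E) (i : ℕ) : Set E :=
  convexHull ℝ {V i, V (i + 1), V (i + 2)}

/-- `V 1, …, V (n+2)` are the vertices of a strip of `n` triangles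
`Δ₁, …, Δₙ`, where `Δᵢ = [Vᵢ, Vᵢ₊₁, Vᵢ₊₂]`. -/
structure IsStrip (n : ℕ) (V : ℕ → E) : Prop where
  indep : ∀ i, 1 ≤ i → i ≤ n → AffineIndependent ℝ ![V i, V (i + 1), V (i + 2)]
  adj : ∀ i, 1 ≤ i → i + 1 ≤ n →
    tri V i ∩ tri V (i + 1) = segment ℝ (V (i + 1)) (V (i + 2))
  touch : ∀ i, 1 ≤ i → i + 2 ≤ n → tri V i ∩ tri V (i + 2) = {V (i + 2)}
  disj : ∀ i j, 1 ≤ i → j ≤ n → i + 3 ≤ j → tri V i ∩ tri V j = ∅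

/-- The underlying set `|△̄ₖᵐ|` of the (sub)strip consisting of the triangles
`Δ k, …, Δ m`. -/
def stripSet (V : ℕ → E) (k m : ℕ) : Set E :=
  ⋃ i ∈ Finset.Icc k m, tri V i

/-- The space `S(△̄ₖᵐ)` of continuous functions on the strip `|△̄ₖᵐ|` whose
restriction to each triangle `Δᵢ`, `k ≤ i ≤ m`, agrees with an affine
function `ℝ² → ℝ`. -/
def stripSpace (V : ℕ → E) (k m : ℕ) : Submodule ℝ (stripSet V k m → ℝ) where
  carrier := {s | Continuous s ∧ ∀ i ∈ Finset.Icc k m, ∃ f : E →ᵃ[ℝ] ℝ,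
    ∀ x : stripSet V k m, (x : E) ∈ tri V i → s x = f x}
  add_mem' := by
    rintro a b ⟨hca, ha⟩ ⟨hcb, hb⟩
    refine ⟨hca.add hcb, fun i hi => ?_⟩
    obtain ⟨f, hf⟩ := ha i hi
    obtain ⟨g, hg⟩ := hb i hi
    exact ⟨f + g, fun x hx => by simp [hf x hx, hg x hx]⟩
  zero_mem' := ⟨continuous_const, fun i hi => ⟨0, fun x hx => by simp⟩⟩
  smul_mem' := by
    rintro c a ⟨hca, ha⟩
    refine ⟨hca.const_smul c, fun i hi => ?_⟩
    obtain ⟨f, hf⟩ := ha i hi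
    exact ⟨c • f, fun x hx => by simp [hf x hx]⟩

/-- Poisedness of a node set `A` for a subspace `T` of the functions on the
strip `|△̄ₖᵐ|`: for every data `c` there is a unique `s ∈ T` interpolating
`c` at the nodes. -/
def PoisedFor (V : ℕ → E) (k m : ℕ) (T : Submodule ℝ (stripSet V k m → ℝ))
    (A : Finset E) : Prop :=
  ∀ c : E → ℝ, ∃! s : stripSet V k m → ℝ,
    s ∈ T ∧ ∀ a : stripSet V k m, (a : E) ∈ A → s a = c a

/-- Poisedness of the interpolation problem `{△̄ₖᵐ, A}`. -/
def Poised (V : ℕ → E) (k m : ℕ) (A : Finset E) : Prop :=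
  PoisedFor V k m (stripSpace V k m) A

/-- The node set `Aₖᵐ = A ∩ |△̄ₖᵐ|` of the subproblem `{△̄, A}ₖᵐ`. -/
def nodesIn (V : ℕ → E) (k m : ℕ) (A : Finset E) : Finset E :=
  A.filter (fun x => x ∈ stripSet V k m)

/-- The nodes of `A` lying in the triangle `Δᵢ`. -/
def triNodes (V : ℕ → E) (i : ℕ) (A : Finset E) : Finset E :=
  A.filter (fun x => x ∈ tri V i)

theorem vertices_subset_tri (V : ℕ → E) (i : ℕ) :
    {V i, V (i + 1), V (i + 2)} ⊆ tri V i :=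
  subset_convexHull ℝ _

theorem isClosed_tri (V : ℕ → E) (i : ℕ) : IsClosed (tri V i) := by
  have hfin : ({V i, V (i + 1), V (i + 2)} : Set E).Finite := by simp
  exact (hfin.isCompact_convexHull (𝕜 := ℝ)).isClosed

theorem tri_subset_stripSet (V : ℕ → E) {k m i : ℕ} (hi : i ∈ Finset.Icc k m) :
    tri V i ⊆ stripSet V k m :=
  Set.subset_biUnion_of_mem (u := fun i => tri V i) hi

/-- Two affine functions agreeing on a set agree on its convex hull. -/
theorem AffineMap.eqOn_convexHull {F : Type*} [AddCommGroup F] [Module ℝ F]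
    {f g : F →ᵃ[ℝ] ℝ} {s : Set F} (h : Set.EqOn f g s) :
    Set.EqOn f g (convexHull ℝ s) := by
  have hconv : Convex ℝ ((f - g) ⁻¹' {0}) :=
    (convex_singleton (0 : ℝ)).affine_preimage (f - g)
  have hs : s ⊆ (f - g) ⁻¹' {0} := fun x hx => by simp [h hx]
  intro x hx
  simpa [sub_eq_zero] using convexHull_min hs hconv hx

/-- Affine interpolation at three affinely independent points of the plane. -/
theorem exists_affineMap_interpolating {p : Fin 3 → E} (hp : AffineIndependent ℝ p)
    (c : Fin 3 → ℝ) : ∃ f : E →ᵃ[ℝ] ℝ, ∀ j, f (p j) = c j := by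
  have htop : affineSpan ℝ (Set.range p) = ⊤ := by
    rw [hp.affineSpan_eq_top_iff_card_eq_finrank_add_one]
    simp
  let b : AffineBasis (Fin 3) ℝ E := ⟨p, hp, htop⟩
  refine ⟨∑ i, c i • b.coord i, fun j => ?_⟩
  have hb : ∀ i, b.coord i (p j) = if i = j then 1 else 0 := fun i => b.coord_apply i j
  simp only [Fin.sum_univ_three, AffineMap.coe_add, Pi.add_apply, AffineMap.coe_smul,
    Pi.smul_apply, hb, smul_eq_mul]
  fin_cases j <;> simp

/-- The points `V k, …, V (m + 2)` belong to the strip `|△̄ₖᵐ|`. -/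
theorem vertex_mem_stripSet (V : ℕ → E) {k m j : ℕ} (hkm : k ≤ m) (hk : k ≤ j)
    (hj : j ≤ m + 2) : V j ∈ stripSet V k m := by
  by_cases h : j ≤ m
  · exact tri_subset_stripSet V (Finset.mem_Icc.2 ⟨hk, h⟩) (vertices_subset_tri V j (by simp))
  · refine tri_subset_stripSet V (Finset.mem_Icc.2 ⟨hkm, le_rfl⟩) (vertices_subset_tri V m ?_)
    obtain rfl | rfl : j = m + 1 ∨ j = m + 2 := by omega
    all_goals simp

/-- An element of the strip space vanishing at all the vertices is zero. -/
theorem eq_zero_of_vertices {V : ℕ → E} {k m : ℕ} {s : stripSet V k m → ℝ}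
    (hs : s ∈ stripSpace V k m)
    (h : ∀ j (hj : V j ∈ stripSet V k m), k ≤ j → j ≤ m + 2 → s ⟨V j, hj⟩ = 0) : s = 0 := by
  funext ⟨x, hx⟩
  obtain ⟨i, hi, hxi⟩ := Set.mem_iUnion₂.1 hx
  obtain ⟨f, hf⟩ := hs.2 i hi
  have hsub := vertices_subset_tri V i
  have hmem := Finset.mem_Icc.1 hi
  have hzero : Set.EqOn f (0 : E →ᵃ[ℝ] ℝ) {V i, V (i + 1), V (i + 2)} := by
    have key : ∀ j, k ≤ j → j ≤ m + 2 → V j ∈ tri V i → f (V j) = 0 := fun j hkj hjm hj => by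
      have hj' := tri_subset_stripSet V hi hj
      rw [← hf ⟨V j, hj'⟩ hj, h j hj' hkj hjm]
    rintro y (rfl | rfl | rfl)
    · exact key _ (by omega) (by omega) (hsub (by simp))
    · exact key _ (by omega) (by omega) (hsub (by simp))
    · exact key _ (by omega) (by omega) (hsub (by simp))
  rw [hf ⟨x, hx⟩ hxi]
  exact AffineMap.eqOn_convexHull hzero hxi

/-- Affine pieces with common vertex values agree wherever two triangles of the strip meet. -/
theorem IsStrip.eqOn_inter {n : ℕ} {V : ℕ → E} (hV : IsStrip n V) {c : ℕ → ℝ}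
    {f : ℕ → E →ᵃ[ℝ] ℝ}
    (hf : ∀ i, 1 ≤ i → i ≤ n →
      f i (V i) = c i ∧ f i (V (i + 1)) = c (i + 1) ∧ f i (V (i + 2)) = c (i + 2))
    {i j : ℕ} (hi : 1 ≤ i) (hj : j ≤ n) (hij : i ≤ j) :
    Set.EqOn (f i) (f j) (tri V i ∩ tri V j) := by
  intro x hx
  have hfi := hf i hi (by omega)
  have hfj := hf j (by omega) hj
  obtain rfl | rfl | rfl | h : j = i ∨ j = i + 1 ∨ j = i + 2 ∨ i + 3 ≤ j := by omega
  · rfl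
  · rw [hV.adj i hi hj, ← convexHull_pair] at hx
    refine AffineMap.eqOn_convexHull ?_ hx
    rintro y (rfl | rfl)
    · exact hfi.2.1.trans hfj.1.symm
    · exact hfi.2.2.trans hfj.2.1.symm
  · rw [hV.touch i hi hj] at hx
    obtain rfl := hx
    exact hfi.2.2.trans hfj.1.symm
  · rw [hV.disj i j hi hj h] at hx
    exact hx.elim

/-- The strip space contains a function with arbitrary prescribed values at the vertices. -/
theorem IsStrip.exists_mem_stripSpace {n : ℕ} (hn : 1 ≤ n) {V : ℕ → E} (hV : IsStrip n V)
    (c : ℕ → ℝ) : ∃ s ∈ stripSpace V 1 n,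
      ∀ j (hj : V j ∈ stripSet V 1 n), 1 ≤ j → j ≤ n + 2 → s ⟨V j, hj⟩ = c j := by
  have hex : ∀ i, ∃ f : E →ᵃ[ℝ] ℝ, 1 ≤ i → i ≤ n →
      f (V i) = c i ∧ f (V (i + 1)) = c (i + 1) ∧ f (V (i + 2)) = c (i + 2) := by
    intro i
    by_cases hi : 1 ≤ i ∧ i ≤ n
    · obtain ⟨f, hf⟩ := exists_affineMap_interpolating (hV.indep i hi.1 hi.2)
        ![c i, c (i + 1), c (i + 2)]
      exact ⟨f, fun _ _ => ⟨hf 0, hf 1, hf 2⟩⟩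
    · exact ⟨0, fun h h' => (hi ⟨h, h'⟩).elim⟩
  choose f hf using hex
  have hcover : ∀ x : stripSet V 1 n, ∃ i ∈ Finset.Icc 1 n, (x : E) ∈ tri V i := fun x => by
    simpa only [stripSet, Set.mem_iUnion₂, exists_prop] using x.2
  choose t ht hxt using hcover
  have hs : ∀ i ∈ Finset.Icc 1 n, ∀ x : stripSet V 1 n, (x : E) ∈ tri V i →
      f (t x) x = f i x := by
    intro i hi x hx
    have hi' := Finset.mem_Icc.1 hi
    have ht' := Finset.mem_Icc.1 (ht x)
    rcases le_total (t x) i with h | h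
    · exact hV.eqOn_inter hf ht'.1 hi'.2 h ⟨hxt x, hx⟩
    · exact (hV.eqOn_inter hf hi'.1 ht'.2 h ⟨hx, hxt x⟩).symm
  refine ⟨fun x => f (t x) x, ⟨?_, fun i hi => ⟨f i, hs i hi⟩⟩, fun j hj hj1 hjn => ?_⟩
  · refine (locallyFinite_of_finite fun i : Finset.Icc 1 n =>
      ((↑) : stripSet V 1 n → E) ⁻¹' tri V i).continuous ?_ ?_ ?_
    · exact Set.eq_univ_of_forall fun x => Set.mem_iUnion.2 ⟨⟨t x, ht x⟩, hxt x⟩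
    · exact fun i => (isClosed_tri V i).preimage continuous_subtype_val
    · exact fun i => ((f i).continuous_of_finiteDimensional.comp
        continuous_subtype_val).continuousOn.congr fun x hx => hs i i.2 x hx
  · by_cases h : j ≤ n
    · exact (hs j (Finset.mem_Icc.2 ⟨hj1, h⟩) ⟨V j, hj⟩ (vertices_subset_tri V j (by simp))).trans
        (hf j hj1 h).1
    · have hfn := hf n hn le_rfl
      have hsn := hs n (Finset.mem_Icc.2 ⟨hn, le_rfl⟩) ⟨V j, hj⟩
      obtain rfl | rfl : j = n + 1 ∨ j = n + 2 := by omega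
      · exact (hsn (vertices_subset_tri V n (by simp))).trans hfn.2.1
      · exact (hsn (vertices_subset_tri V n (by simp))).trans hfn.2.2

/-- Evaluation of the elements of the strip space at the vertices `V 1, …, V (n + 2)`. -/
def vertexEval (n : ℕ) (hn : 1 ≤ n) (V : ℕ → E) :
    stripSpace V 1 n →ₗ[ℝ] (Fin (n + 2) → ℝ) :=
  (LinearMap.funLeft ℝ ℝ fun j : Fin (n + 2) =>
    (⟨V (j + 1), vertex_mem_stripSet V hn (by omega) (by omega)⟩ : stripSet V 1 n)) ∘ₗ
    (stripSpace V 1 n).subtype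

theorem IsStrip.vertexEval_bijective {n : ℕ} (hn : 1 ≤ n) {V : ℕ → E} (hV : IsStrip n V) :
    Function.Bijective (vertexEval n hn V) := by
  constructor
  · refine (injective_iff_map_eq_zero _).2 fun s hs => Subtype.ext ?_
    refine eq_zero_of_vertices s.2 fun j hj hj1 hjn => ?_
    obtain ⟨j, rfl⟩ := Nat.exists_eq_add_of_le' hj1
    exact congrFun hs ⟨j, by omega⟩
  · intro c
    obtain ⟨s, hs, hsc⟩ := hV.exists_mem_stripSpace hn
      fun j => if h : j - 1 < n + 2 then c ⟨j - 1, h⟩ else 0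
    refine ⟨⟨s, hs⟩, funext fun j => ?_⟩
    refine (hsc (j + 1) _ (by omega) (by omega)).trans ?_
    simp

/-- For a strip of `n` triangles `△̄`, the space `S(△̄)` of
continuous piecewise linear functions on the strip has dimension `n + 2`. -/
theorem dim_stripSpace (n : ℕ) (hn : 1 ≤ n) (V : ℕ → E) (hV : IsStrip n V) :
    Module.finrank ℝ (stripSpace V 1 n) = n + 2 := by
  rw [(LinearEquiv.ofBijective _ (hV.vertexEval_bijective hn)).finrank_eq, Module.finrank_fin_fun]
end
end

section
/- Every exact interpolation problem {△̄, A} on a strip of n triangles has a subproblem {△̄, A}ₖᵐ of one of the following types: type "3" (a single triangle, m = k, containing at least three nodes of A), type "2+2" (two consecutive triangles each containing exactly two nodes of A), or type "2+1+⋯+1+2,m'" with m' ≥ 1 (a block of m'+2 consecutive triangles whose first and last triangles each contain exactly two nodes of A and whose m' middle triangles each contain exactly one node of A). -/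
open scoped Classical

noncomputable section

/-- A sequence with values at most `2` whose partial sums exceed the number of terms by `2` contains
two terms equal to `2` separated only by terms equal to `1`. -/
theorem exists_two_ones_two (t : ℕ → ℕ) (n : ℕ) (ht : ∀ i, 1 ≤ i → i ≤ n → t i ≤ 2)
    (hsum : n + 2 ≤ ∑ i ∈ Finset.Icc 1 n, t i) :
    ∃ k m, 1 ≤ k ∧ k < m ∧ m ≤ n ∧ t k = 2 ∧ t m = 2 ∧ ∀ j, k < j → j < m → t j = 1 := by
  by_contra hno
  have key : ∀ N ≤ n, ∑ i ∈ Finset.Icc 1 N, t i ≤ N ∨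
      (∑ i ∈ Finset.Icc 1 N, t i = N + 1 ∧
        ∃ k, 1 ≤ k ∧ k ≤ N ∧ t k = 2 ∧ ∀ j, k < j → j ≤ N → t j = 1) := by
    intro N
    induction N with
    | zero => simp
    | succ N ih =>
      intro hN
      rw [Finset.sum_Icc_succ_top (by omega)]
      have h2 := ht (N + 1) (by omega) hN
      rcases ih (by omega) with h | ⟨h, k, hk1, hkN, hk, hones⟩
      · by_cases hlt : ∑ i ∈ Finset.Icc 1 N, t i + t (N + 1) ≤ N + 1
        · exact Or.inl hlt
        · exact Or.inr ⟨by omega, N + 1, by omega, le_rfl, by omega, fun j _ _ => by omega⟩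
      · have hne : t (N + 1) ≠ 2 := fun h' =>
          hno ⟨k, N + 1, hk1, by omega, hN, hk, h', fun j hj hj' => hones j hj (by omega)⟩
        by_cases h1 : t (N + 1) = 1
        · refine Or.inr ⟨by omega, k, hk1, by omega, hk, fun j hj hj' => ?_⟩
          rcases hj'.eq_or_lt with rfl | hlt
          · exact h1
          · exact hones j hj (by omega)
        · exact Or.inl (by omega)
  rcases key n le_rfl with h | ⟨h, -⟩ <;> omega

/-- The numbers of nodes in the triangles of a strip add up to at least the number of nodes. -/
theorem card_le_sum_card_triNodes (n : ℕ) (V : ℕ → E) (A : Finset E) (hA : ↑A ⊆ stripSet V 1 n) :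
    A.card ≤ ∑ i ∈ Finset.Icc 1 n, (triNodes V i A).card := by
  refine le_trans (Finset.card_le_card fun x hx => ?_) Finset.card_biUnion_le
  obtain ⟨i, hi, hxi⟩ := Set.mem_iUnion₂.1 (hA hx)
  exact Finset.mem_biUnion.2 ⟨i, hi, Finset.mem_filter.2 ⟨hx, hxi⟩⟩

/-- every exact problem `{△̄, A}` has a subproblem of type
"3" (one triangle containing at least three nodes), "2+2" (two consecutive
triangles with exactly two nodes each), or "2+1+⋯+1+2,m'" with `m' ≥ 1`
(a block whose first and last triangles contain exactly two nodes each and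
whose middle triangles contain exactly one node each). -/
theorem exists_subproblem (n : ℕ) (hn : 1 ≤ n) (V : ℕ → E)
    (hV : IsStrip n V) (A : Finset E) (hA : ↑A ⊆ stripSet V 1 n)
    (hexact : A.card = n + 2) :
    ∃ k m, 1 ≤ k ∧ k ≤ m ∧ m ≤ n ∧
      ((k = m ∧ 3 ≤ (triNodes V k A).card) ∨
       (m = k + 1 ∧ (triNodes V k A).card = 2 ∧
         (triNodes V m A).card = 2) ∨
       (k + 2 ≤ m ∧ (triNodes V k A).card = 2 ∧
         (triNodes V m A).card = 2 ∧
         ∀ j, k + 1 ≤ j → j + 1 ≤ m → (triNodes V j A).card = 1)) := by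
  by_cases h3 : ∃ k, 1 ≤ k ∧ k ≤ n ∧ 3 ≤ (triNodes V k A).card
  · obtain ⟨k, hk1, hkn, hk⟩ := h3
    exact ⟨k, k, hk1, le_rfl, hkn, Or.inl ⟨rfl, hk⟩⟩
  · have hle : ∀ i, 1 ≤ i → i ≤ n → (triNodes V i A).card ≤ 2 := fun i hi hin => by
      by_contra h
      exact h3 ⟨i, hi, hin, by omega⟩
    obtain ⟨k, m, hk1, hkm, hmn, hk, hm, hones⟩ :=
      exists_two_ones_two (fun i => (triNodes V i A).card) n hle
        (hexact ▸ card_le_sum_card_triNodes n V A hA)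
    refine ⟨k, m, hk1, hkm.le, hmn, Or.inr ?_⟩
    rcases (Nat.succ_le_of_lt hkm).eq_or_lt with h | h
    · exact Or.inl ⟨h.symm, hk, hm⟩
    · exact Or.inr ⟨h, hk, hm, fun j hj hj' => hones j hj hj'⟩
end
end
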